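/- arXiv:2105.08983 — 2 statements merged into one kernel-verified Lean document; each statement's English description precedes it below -/
import Mathlib

section
/- For every infinitely differentiable compactly supported function φ : ℝ → ℝ and every x ∈ ℝ, the two principal values H̃[φ](x) := lim_{ε→0⁺} ∫_{|x−y|≥ε} (φ(x) − φ(y))/(x−y)² dy and H[φ'](x) := lim_{ε→0⁺} ∫_{|x−y|≥ε} φ'(y)/(x−y) dy both exist and are equal. -/
open Filter Set MeasureTheory Topology

/-- The principal value `H̃[φ](x) = pv ∫ (φ(x) - φ(y))/(x-y)² dy` converges to `L`. -/
def HTildeTendsto (φ : ℝ → ℝ) (x L : ℝ) : Prop :=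
  Tendsto (fun ε : ℝ => ∫ y in {y : ℝ | ε ≤ |x - y|}, (φ x - φ y) / (x - y) ^ 2)
    (𝓝[>] 0) (𝓝 L)

/-- The value of the principal value `H̃[φ](x)` (junk value if the limit does not exist). -/
noncomputable def HTilde (φ : ℝ → ℝ) (x : ℝ) : ℝ :=
  limUnder (𝓝[>] (0 : ℝ))
    (fun ε : ℝ => ∫ y in {y : ℝ | ε ≤ |x - y|}, (φ x - φ y) / (x - y) ^ 2)


/-- The Hilbert-transform principal value `H[μ](x) = pv ∫ μ(y)/(x-y) dy` converges to `L`. -/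
def HilbertTendsto (μ : ℝ → ℝ) (x L : ℝ) : Prop :=
  Tendsto (fun ε : ℝ => ∫ y in {y : ℝ | ε ≤ |x - y|}, μ y / (x - y))
    (𝓝[>] 0) (𝓝 L)

/-- The integral over the complement of an interval centred at `x`, folded onto a half-line. -/
theorem setIntegral_le_abs_sub_eq {f : ℝ → ℝ} {x ε : ℝ} (hε : 0 < ε)
    (hp : IntegrableOn (fun t => f (x + t)) (Ioi ε))
    (hm : IntegrableOn (fun t => f (x - t)) (Ioi ε)) :
    ∫ y in {y : ℝ | ε ≤ |x - y|}, f y = ∫ t in Ioi ε, (f (x - t) + f (x + t)) := by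
  have htrans : ∫ y in {y : ℝ | ε ≤ |x - y|}, f y = ∫ t in {t : ℝ | ε ≤ |t|}, f (x + t) := by
    have h := (measurePreserving_add_left volume x).setIntegral_preimage_emb
      (measurableEmbedding_addLeft x) f {y : ℝ | ε ≤ |x - y|}
    rw [← h]
    congr 2
    ext t
    simp
  have hset : {t : ℝ | ε ≤ |t|} = Iic (-ε) ∪ Ici ε := by
    ext t
    simp only [mem_ofPred_eq, mem_union, mem_Iic, mem_Ici, le_abs']
  have hm' : IntegrableOn (fun t => f (x + t)) (Iic (-ε)) := by
    rw [← integrableOn_Ici_iff_integrableOn_Ioi] at hm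
    simpa [sub_eq_add_neg] using hm.comp_neg
  have hdisj : Disjoint (Iic (-ε)) (Ici ε) :=
    Iic_disjoint_Ici.2 (by linarith)
  have hneg : ∫ t in Iic (-ε), f (x + t) = ∫ t in Ioi ε, f (x - t) := by
    simpa [sub_eq_add_neg] using integral_comp_neg_Iic (-ε) (fun t => f (x - t))
  rw [htrans, hset, setIntegral_union hdisj measurableSet_Ici hm'
    ((integrableOn_Ici_iff_integrableOn_Ioi).2 hp), integral_Ici_eq_integral_Ioi, hneg,
    integral_add hm hp]

/-- A bounded continuous function divided by `t ^ 2` is integrable away from the origin. -/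
theorem integrableOn_Ioi_div_sq {g : ℝ → ℝ} (hg : Continuous g) {M : ℝ} (hM : ∀ t, |g t| ≤ M)
    {ε : ℝ} (hε : 0 < ε) : IntegrableOn (fun t => g t / t ^ 2) (Ioi ε) := by
  have h2 : IntegrableOn (fun t : ℝ => t ^ (-2 : ℝ)) (Ioi ε) :=
    integrableOn_Ioi_rpow_of_lt (by norm_num) hε
  refine (h2.const_mul M).mono'
    (hg.measurable.div (measurable_id.pow_const 2)).aestronglyMeasurable ?_
  filter_upwards [ae_restrict_mem measurableSet_Ioi] with t ht
  have ht0 : 0 < t := hε.trans ht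
  rw [Real.rpow_neg ht0.le, Real.rpow_two, Real.norm_eq_abs, abs_div, abs_of_pos (pow_pos ht0 2),
    ← div_eq_mul_inv]
  gcongr
  exact hM t

/-- An integrable function divided by `t` is integrable away from the origin. -/
theorem integrableOn_Ioi_div_id {g : ℝ → ℝ} (hg : Integrable g) {ε : ℝ} (hε : 0 < ε) :
    IntegrableOn (fun t => g t / t) (Ioi ε) := by
  refine (hg.norm.integrableOn.const_mul ε⁻¹).mono'
    (hg.aestronglyMeasurable.restrict.aemeasurable.div aemeasurable_id).aestronglyMeasurable ?_
  filter_upwards [ae_restrict_mem measurableSet_Ioi] with t ht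
  have ht0 : 0 < t := hε.trans ht
  rw [norm_div, Real.norm_of_nonneg ht0.le, div_eq_inv_mul]
  gcongr
  exact ht.le

/-- The integral over `(ε, ∞)` of a quotient `h t / t` converges as `ε → 0⁺` when `h` has compact
support, is continuous, and is differentiable at its zero `0`. -/
theorem exists_tendsto_integral_Ioi_div_id {h : ℝ → ℝ} (hc : Continuous h)
    (hs : HasCompactSupport h) (hd : DifferentiableAt ℝ h 0) (h0 : h 0 = 0) :
    ∃ L : ℝ, Tendsto (fun ε : ℝ => ∫ t in Ioi ε, h t / t) (𝓝[>] 0) (𝓝 L) := by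
  have hslope : ∀ t ≠ 0, dslope h 0 t = h t / t := fun t ht => by
    rw [dslope_of_ne h ht, slope_def_field, h0, sub_zero, sub_zero]
  have hcont : Continuous (dslope h 0) := by
    rw [← continuousOn_univ, continuousOn_dslope univ_mem]
    exact ⟨hc.continuousOn, hd⟩
  have hsupp : HasCompactSupport (dslope h 0) := by
    refine HasCompactSupport.intro (hs.isCompact.union (isCompact_singleton (x := (0 : ℝ)))) ?_
    intro t ht
    simp only [mem_union, mem_singleton_iff, not_or] at ht
    rw [hslope t ht.2, image_eq_zero_of_notMem_tsupport ht.1, zero_div]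
  have hint : Integrable (dslope h 0) := hcont.integrable_of_hasCompactSupport hsupp
  refine ⟨∫ t in Ioi 0, dslope h 0 t, ?_⟩
  have hprim : Continuous fun ε : ℝ => ∫ t in (0 : ℝ)..ε, dslope h 0 t :=
    intervalIntegral.continuous_primitive (fun _ _ => hint.intervalIntegrable) 0
  have hlim : Tendsto (fun ε : ℝ => (∫ t in Ioi 0, dslope h 0 t) - ∫ t in (0 : ℝ)..ε, dslope h 0 t)
      (𝓝[>] 0) (𝓝 (∫ t in Ioi 0, dslope h 0 t)) := by
    have hzero : Tendsto (fun ε : ℝ => ∫ t in (0 : ℝ)..ε, dslope h 0 t) (𝓝 0) (𝓝 0) := by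
      simpa using hprim.tendsto 0
    simpa using (hzero.mono_left nhdsWithin_le_nhds).const_sub (∫ t in Ioi 0, dslope h 0 t)
  refine hlim.congr' ?_
  filter_upwards [self_mem_nhdsWithin] with ε hε
  have hsplit := intervalIntegral.integral_Ioi_sub_Ioi (f := dslope h 0) (μ := volume)
    hint.integrableOn (le_of_lt hε)
  rw [← hsplit, sub_sub_cancel]
  exact setIntegral_congr_fun measurableSet_Ioi fun t ht => hslope t (ne_of_gt (lt_trans hε ht))

/-- Integration by parts against `t⁻²` on a half-line. -/
theorem integral_Ioi_div_sq_eq {s h : ℝ → ℝ} (hs : ∀ t, HasDerivAt s (h t) t) {M : ℝ}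
    (hM : ∀ t, |s t| ≤ M) (hh : Integrable h) {ε : ℝ} (hε : 0 < ε) :
    ∫ t in Ioi ε, s t / t ^ 2 = s ε / ε + ∫ t in Ioi ε, h t / t := by
  have hsc : Continuous s := continuous_iff_continuousAt.2 fun t => (hs t).continuousAt
  have hi1 := integrableOn_Ioi_div_sq hsc hM hε
  have hi2 := integrableOn_Ioi_div_id hh hε
  have hderiv : ∀ t ∈ Ici ε, HasDerivAt (fun t => -(s t / t)) (s t / t ^ 2 - h t / t) t := by
    intro t ht
    have ht0 : t ≠ 0 := (lt_of_lt_of_le hε ht).ne'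
    refine ((hs t).div (hasDerivAt_id' t) ht0).neg.congr_deriv ?_
    field_simp
    ring
  have hlim : Tendsto (fun t => -(s t / t)) atTop (𝓝 0) := by
    have hbound : Tendsto (fun t : ℝ => M / t) atTop (𝓝 0) := tendsto_id.const_div_atTop M
    refine squeeze_zero_norm' ?_ hbound
    filter_upwards [eventually_gt_atTop 0] with t ht
    rw [norm_neg, norm_div, Real.norm_of_nonneg ht.le]
    gcongr
    exact hM t
  have key := integral_Ioi_of_hasDerivAt_of_tendsto' hderiv (hi1.sub hi2) hlim
  rw [integral_sub hi1 hi2] at key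
  linarith

/-- For `φ` infinitely differentiable with compact support and any `x`,
the principal values `H̃[φ](x)` and `H[φ'](x)` both exist and are equal. -/
theorem htilde_eq_hilbert_deriv
    (φ : ℝ → ℝ) (hφ : ∀ n : ℕ, ContDiff ℝ n φ) (hsupp : HasCompactSupport φ) (x : ℝ) :
    ∃ L : ℝ, HTildeTendsto φ x L ∧ HilbertTendsto (deriv φ) x L := by
  have hφ2 : ContDiff ℝ 2 φ := hφ 2
  have hdiff : Differentiable ℝ φ := hφ2.differentiable (by norm_num)
  have hφ' : ContDiff ℝ 1 (deriv φ) := hφ2.deriv'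
  have hcφ : Continuous φ := hdiff.continuous
  have hcφ' : Continuous (deriv φ) := hφ'.continuous
  have hdiff' : Differentiable ℝ (deriv φ) := hφ'.differentiable (by norm_num)
  obtain ⟨C, hC⟩ := hsupp.exists_bound_of_continuous hcφ
  simp only [Real.norm_eq_abs] at hC
  have hip : Integrable fun t => deriv φ (x + t) :=
    (hcφ'.integrable_of_hasCompactSupport hsupp.deriv).comp_add_left x
  have him : Integrable fun t => deriv φ (x - t) :=
    (hcφ'.integrable_of_hasCompactSupport hsupp.deriv).comp_sub_left x
  have hsp : HasCompactSupport fun t => deriv φ (x + t) :=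
    hsupp.deriv.comp_homeomorph (Homeomorph.addLeft x)
  have hsm : HasCompactSupport fun t => deriv φ (x - t) :=
    hsupp.deriv.comp_homeomorph (Homeomorph.subLeft x)
  set s : ℝ → ℝ := fun t => (φ x - φ (x - t)) + (φ x - φ (x + t)) with hs
  set h : ℝ → ℝ := fun t => deriv φ (x - t) - deriv φ (x + t) with hh
  have hder : ∀ t, HasDerivAt s (h t) t := by
    intro t
    have h1 := ((hdiff (x - t)).hasDerivAt.comp_const_sub x t).const_sub (φ x)
    have h2 := ((hdiff (x + t)).hasDerivAt.comp_const_add x t).const_sub (φ x)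
    refine (h1.add h2).congr_deriv ?_
    simp only [hh]
    ring
  have hbm : ∀ t, |φ x - φ (x - t)| ≤ C + C := fun t =>
    (abs_sub _ _).trans (add_le_add (hC _) (hC _))
  have hbp : ∀ t, |φ x - φ (x + t)| ≤ C + C := fun t =>
    (abs_sub _ _).trans (add_le_add (hC _) (hC _))
  have hbs : ∀ t, |s t| ≤ (C + C) + (C + C) := fun t =>
    (abs_add_le _ _).trans (add_le_add (hbm t) (hbp t))
  obtain ⟨L, hL⟩ := exists_tendsto_integral_Ioi_div_id (h := h) (by fun_prop) (hsm.sub hsp)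
    (by fun_prop) (by simp [hh])
  have hboundary : Tendsto (fun ε => s ε / ε) (𝓝[>] 0) (𝓝 0) := by
    have := (hder 0).tendsto_slope_zero_right
    simpa [hs, hh, div_eq_inv_mul] using this
  refine ⟨L, ?_, ?_⟩
  · have hsum := hboundary.add hL
    rw [zero_add] at hsum
    refine hsum.congr' ?_
    filter_upwards [self_mem_nhdsWithin] with ε hε
    have hε : 0 < ε := hε
    have hp := integrableOn_Ioi_div_sq (g := fun t => φ x - φ (x + t)) (by fun_prop) hbp hε
    have hm := integrableOn_Ioi_div_sq (g := fun t => φ x - φ (x - t)) (by fun_prop) hbm hε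
    rw [← integral_Ioi_div_sq_eq hder hbs (him.sub hip) hε,
      setIntegral_le_abs_sub_eq hε (by simpa using hp) (by simpa using hm)]
    congr 1
    ext t
    simp [hs, add_div]
  · refine hL.congr' ?_
    filter_upwards [self_mem_nhdsWithin] with ε hε
    have hε : 0 < ε := hε
    have hp := (integrableOn_Ioi_div_id hip hε).neg
    have hm := integrableOn_Ioi_div_id him hε
    rw [setIntegral_le_abs_sub_eq hε (by simpa [div_neg, Pi.neg_def] using hp) (by simpa using hm)]
    congr 1
    ext t
    simp only [hh, sub_sub_cancel, sub_add_cancel_left, div_neg]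
    ring
end

section
/- Let F₁, F₂ : [0,∞) × ℝ → ℝ be bounded continuous functions, differentiable in time on (0,∞) × ℝ and, for each t ≥ 0, bounded in space with bounded second spatial derivative, such that F₁ and F₂ solve ∂ₜF + (∂ₓF) H̃[F(t,·)] = 0 pointwise on (0,∞) × ℝ and F₁(t,·), F₂(t,·) are nondecreasing for every t ≥ 0. If F₁(0,·) ≤ F₂(0,·) on ℝ, then F₁(t,·) ≤ F₂(t,·) on ℝ for every t ≥ 0. -/
open Filter Set MeasureTheory Topology

/-- The part of the hypotheses on a solution of the primitive Dyson equation
which the comparison argument uses. -/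
structure IsDysonSolution (F Ft Fx : ℝ → ℝ → ℝ) (M : ℝ) : Prop where
  bound : ∀ t x, 0 ≤ t → |F t x| ≤ M
  cont : ContinuousOn (fun p : ℝ × ℝ => F p.1 p.2) (Set.Ici 0 ×ˢ Set.univ)
  deriv_time : ∀ t x, 0 < t → HasDerivAt (fun s => F s x) (Ft t x) t
  deriv_space : ∀ t x, 0 ≤ t → HasDerivAt (F t) (Fx t x) x
  mono : ∀ t, 0 ≤ t → Monotone (F t)
  eqn : ∀ t x, 0 < t → ∃ L : ℝ, HTildeTendsto (F t) x L ∧ Ft t x + Fx t x * L = 0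

theorem integrableOn_truncated_kernel {f : ℝ → ℝ} {M : ℝ} (hf : Continuous f)
    (hM : ∀ y, |f y| ≤ M) (x : ℝ) {ε : ℝ} (hε : 0 < ε) :
    IntegrableOn (fun y => (f x - f y) / (x - y) ^ 2) {y : ℝ | ε ≤ |x - y|} := by
  have hS : MeasurableSet {y : ℝ | ε ≤ |x - y|} :=
    (isClosed_le continuous_const (by fun_prop)).measurableSet
  have hg : Integrable (fun y : ℝ => 2 * M * (1 + 1 / ε ^ 2) * (1 + (x - y) ^ 2)⁻¹) :=
    (integrable_inv_one_add_sq.comp_sub_left x).const_mul _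
  refine Integrable.mono' hg.integrableOn ?_ ?_
  · have hm := hf.measurable
    exact Measurable.aestronglyMeasurable (by fun_prop)
  · refine (ae_restrict_iff' hS).2 (Eventually.of_forall fun y hy => ?_)
    have hy' : ε ≤ |x - y| := hy
    have hs : ε ^ 2 ≤ (x - y) ^ 2 := by
      rw [← sq_abs (x - y)]
      gcongr
    have hε2 : 0 < ε ^ 2 := by positivity
    have hs0 : 0 < (x - y) ^ 2 := by linarith
    have h1 : |f x - f y| ≤ 2 * M := by
      have h2 := abs_le.1 (hM x)
      have h3 := abs_le.1 (hM y)
      rw [abs_le]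
      constructor <;> linarith
    have hM0 : 0 ≤ 2 * M := (abs_nonneg _).trans h1
    rw [Real.norm_eq_abs, abs_div, abs_of_pos hs0, div_eq_mul_inv, mul_assoc]
    refine mul_le_mul h1 ?_ (by positivity) hM0
    rw [← div_eq_mul_inv, le_div_iff₀ (by positivity), inv_mul_le_iff₀ hs0]
    have h4 : 1 ≤ (x - y) ^ 2 * (1 / ε ^ 2) := by
      rw [mul_one_div, le_div_iff₀ hε2]
      linarith
    nlinarith

/-- The principal value is monotone in the increments at the base point. -/
theorem HTildeTendsto.le_of_increments {f g : ℝ → ℝ} {M x L₁ L₂ : ℝ} (hf : Continuous f)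
    (hg : Continuous g) (hfM : ∀ y, |f y| ≤ M) (hgM : ∀ y, |g y| ≤ M)
    (h₁ : HTildeTendsto f x L₁) (h₂ : HTildeTendsto g x L₂)
    (h : ∀ y, g x - g y ≤ f x - f y) : L₂ ≤ L₁ := by
  refine le_of_tendsto_of_tendsto h₂ h₁ ?_
  filter_upwards [self_mem_nhdsWithin] with ε hε
  refine setIntegral_mono (integrableOn_truncated_kernel hg hgM x hε)
    (integrableOn_truncated_kernel hf hfM x hε) fun y => ?_
  have := h y
  dsimp only
  gcongr

/-- A lower bound on symmetric second differences bounds the principal value from below. -/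
theorem HTildeTendsto.ge_of_second_difference {f : ℝ → ℝ} {M x L C : ℝ} (hf : Continuous f)
    (hfM : ∀ y, |f y| ≤ M) (hL : HTildeTendsto f x L) (hC : 0 ≤ C)
    (h : ∀ s, -(2 * C) / (1 + s ^ 2) ≤ (2 * f x - f (x - s) - f (x + s)) / s ^ 2) :
    -(C * Real.pi) ≤ L := by
  refine ge_of_tendsto hL ?_
  filter_upwards [self_mem_nhdsWithin] with ε hε
  have hε' : 0 < ε := hε
  have hS : MeasurableSet {y : ℝ | ε ≤ |x - y|} :=
    (isClosed_le continuous_const (by fun_prop)).measurableSet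
  set k : ℝ → ℝ := {y : ℝ | ε ≤ |x - y|}.indicator (fun y => (f x - f y) / (x - y) ^ 2) with hk
  have hki : Integrable k :=
    (integrable_indicator_iff hS).2 (integrableOn_truncated_kernel hf hfM x hε)
  rw [← integral_indicator hS, ← hk]
  have hki' : Integrable (fun s => k (x - s)) := hki.comp_sub_left x
  have hki'' : Integrable (fun s => k (x + s)) := hki.comp_add_left x
  have e1 : ∫ s, k (x - s) = ∫ y, k y := integral_sub_left_eq_self k volume x
  have e2 : ∫ s, k (x + s) = ∫ y, k y := integral_add_left_eq_self k x
  have hlow : ∫ s : ℝ, -(2 * C) * (1 + s ^ 2)⁻¹ ≤ ∫ s, (k (x - s) + k (x + s)) := by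
    refine integral_mono (integrable_inv_one_add_sq.const_mul _) (hki'.add hki'') fun s => ?_
    simp only [hk, Set.indicator_apply, Set.mem_ofPred_eq, sub_sub_cancel, sub_add_cancel_left,
      abs_neg, neg_sq]
    split_ifs
    · refine le_trans (le_of_eq ?_) ((h s).trans (le_of_eq ?_))
      · rw [div_eq_mul_inv]
      · rw [← add_div]
        ring
    · have : 0 ≤ C * (1 + s ^ 2)⁻¹ := by positivity
      linarith
  rw [integral_add hki' hki'', e1, e2, integral_const_mul, integral_univ_inv_one_add_sq] at hlow
  linarith

theorem HTildeTendsto.neg_comp_neg {f : ℝ → ℝ} {x L : ℝ} (h : HTildeTendsto f (-x) L) :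
    HTildeTendsto (fun y => -f (-y)) x (-L) := by
  refine (Tendsto.neg h).congr fun ε => ?_
  have hS : ∀ z : ℝ, MeasurableSet {y : ℝ | ε ≤ |z - y|} := fun z =>
    (isClosed_le continuous_const (by fun_prop)).measurableSet
  rw [← integral_indicator (hS _), ← integral_indicator (hS _), ← integral_neg,
    ← integral_neg_eq_self]
  congr 1
  ext y
  have e : |-x - -y| = |x - y| := by
    rw [← abs_neg]
    congr 1
    ring
  simp only [Set.indicator_apply, Set.mem_ofPred_eq, e]
  split_ifs
  · rw [← neg_div]
    congr 1 <;> ring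
  · simp

theorem IsDysonSolution.continuous_space {F Ft Fx : ℝ → ℝ → ℝ} {M : ℝ}
    (h : IsDysonSolution F Ft Fx M) {t : ℝ} (ht : 0 ≤ t) : Continuous (F t) :=
  continuous_iff_continuousAt.2 fun x => (h.deriv_space t x ht).continuousAt

theorem IsDysonSolution.deriv_space_nonneg {F Ft Fx : ℝ → ℝ → ℝ} {M : ℝ}
    (h : IsDysonSolution F Ft Fx M) {t : ℝ} (ht : 0 ≤ t) (x : ℝ) : 0 ≤ Fx t x :=
  (h.deriv_space t x ht).deriv ▸ Monotone.deriv_nonneg (h.mono t ht)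

/-- The equation is invariant under `F(t, x) ↦ -F(t, -x)`. -/
theorem IsDysonSolution.reflect {F Ft Fx : ℝ → ℝ → ℝ} {M : ℝ} (h : IsDysonSolution F Ft Fx M) :
    IsDysonSolution (fun t x => -F t (-x)) (fun t x => -Ft t (-x)) (fun t x => Fx t (-x)) M where
  bound t x ht := by simpa using h.bound t (-x) ht
  cont := by
    have hc := h.cont.comp (f := fun p : ℝ × ℝ => (p.1, -p.2)) (s := Set.Ici 0 ×ˢ Set.univ)
      (by fun_prop) (fun p hp => ⟨hp.1, Set.mem_univ _⟩)
    exact hc.neg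
  deriv_time t x ht := (h.deriv_time t (-x) ht).neg
  deriv_space t x ht := by
    have := ((h.deriv_space t (-x) ht).comp x (hasDerivAt_neg x)).neg
    exact this.congr_deriv (by simp)
  mono t ht x y hxy := neg_le_neg (h.mono t ht (neg_le_neg hxy))
  eqn t x ht := by
    obtain ⟨L, hL, e⟩ := h.eqn t (-x) ht
    exact ⟨-L, hL.neg_comp_neg, by linarith⟩

theorem HasDerivAt.nonneg_of_left_max {g : ℝ → ℝ} {d t : ℝ} (ht : 0 < t) (hg : HasDerivAt g d t)
    (hmax : ∀ s, 0 ≤ s → s ≤ t → g s ≤ g t) : 0 ≤ d := by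
  have h1 := (hasDerivWithinAt_iff_tendsto_slope' (s := Set.Iio t) (by simp)).1
    hg.hasDerivWithinAt
  refine ge_of_tendsto h1 ?_
  filter_upwards [self_mem_nhdsWithin, mem_nhdsWithin_of_mem_nhds (lt_mem_nhds ht)] with s hs hs0
  have hs' : s < t := hs
  have := hmax s (le_of_lt hs0) hs'.le
  rw [slope_def_field]
  exact div_nonneg_of_nonpos (by linarith) (by linarith)

/-- A function positive somewhere, but nonpositive initially and outside a compact interval,
attains its maximum over a time strip at a positive time. -/
theorem exists_max_pos_time {u : ℝ → ℝ → ℝ} {T a b t₁ x₁ : ℝ}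
    (hu : ContinuousOn (fun p : ℝ × ℝ => u p.1 p.2) (Set.Ici 0 ×ˢ Set.univ))
    (ht₁ : 0 ≤ t₁) (ht₁T : t₁ ≤ T) (hpos : 0 < u t₁ x₁) (h0 : ∀ x, u 0 x ≤ 0)
    (hout : ∀ t x, 0 ≤ t → t ≤ T → x ∉ Set.Icc a b → u t x ≤ 0) :
    ∃ t₀ x₀, 0 < t₀ ∧ t₀ ≤ T ∧ ∀ t x, 0 ≤ t → t ≤ T → u t x ≤ u t₀ x₀ := by
  have hx₁ : x₁ ∈ Set.Icc a b := by
    by_contra hx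
    exact absurd (hout t₁ x₁ ht₁ ht₁T hx) (not_le.2 hpos)
  obtain ⟨⟨t₀, x₀⟩, ⟨ht₀, -⟩, hmax⟩ :=
    ((isCompact_Icc (a := (0 : ℝ)) (b := T)).prod (isCompact_Icc (a := a) (b := b))).exists_isMaxOn
      ⟨(t₁, x₁), ⟨⟨ht₁, ht₁T⟩, hx₁⟩⟩ (hu.mono fun p hp => ⟨hp.1.1, Set.mem_univ _⟩)
  have hm : ∀ t x, 0 ≤ t → t ≤ T → x ∈ Set.Icc a b → u t x ≤ u t₀ x₀ := fun t x h1 h2 h3 =>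
    hmax (show (t, x) ∈ Set.Icc (0 : ℝ) T ×ˢ Set.Icc a b from ⟨⟨h1, h2⟩, h3⟩)
  have hp₀ : 0 < u t₀ x₀ := hpos.trans_le (hm t₁ x₁ ht₁ ht₁T hx₁)
  refine ⟨t₀, x₀, lt_of_le_of_ne ht₀.1 ?_, ht₀.2, fun t x h1 h2 => ?_⟩
  · rintro rfl
    exact absurd (h0 x₀) (not_le.2 hp₀)
  · by_cases hx : x ∈ Set.Icc a b
    · exact hm t x h1 h2 hx
    · exact (hout t x h1 h2 hx).trans hp₀.le

/-- The profile `x² / (R² + x²)` of the barriers. -/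
noncomputable def barrierProfile (R x : ℝ) : ℝ := x ^ 2 / (R ^ 2 + x ^ 2)

theorem barrierProfile_nonneg (R x : ℝ) : 0 ≤ barrierProfile R x := by
  unfold barrierProfile
  positivity

theorem half_le_barrierProfile {R x : ℝ} (hR : 0 < R) (hx : R ≤ |x|) :
    1 / 2 ≤ barrierProfile R x := by
  have h : R ^ 2 ≤ x ^ 2 := by
    rw [← sq_abs x]
    gcongr
  unfold barrierProfile
  rw [div_le_div_iff₀ (by norm_num) (by positivity)]
  linarith

theorem exists_hasDerivAt_barrierProfile {R : ℝ} (hR : 0 < R) (x : ℝ) :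
    ∃ d, HasDerivAt (barrierProfile R) d x ∧ d ≤ 1 / R := by
  have hD : 0 < R ^ 2 + x ^ 2 := by positivity
  have h1 : HasDerivAt (fun x : ℝ => x ^ 2) (2 * x) x := by
    simpa using hasDerivAt_pow 2 x
  refine ⟨_, h1.div (h1.const_add (R ^ 2)) hD.ne', ?_⟩
  rw [div_le_div_iff₀ (by positivity) hR]
  have h2 : 2 * x * R ≤ R ^ 2 + x ^ 2 := by nlinarith [sq_nonneg (R - x)]
  have h3 : R ^ 2 * (2 * x * R) ≤ R ^ 2 * (R ^ 2 + x ^ 2) := by gcongr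
  nlinarith [mul_nonneg (sq_nonneg x) hD.le]

theorem continuous_barrierProfile {R : ℝ} (hR : 0 < R) : Continuous (barrierProfile R) :=
  continuous_iff_continuousAt.2 fun x =>
    (exists_hasDerivAt_barrierProfile hR x).choose_spec.1.continuousAt

theorem barrierProfile_second_difference {R : ℝ} (hR : 1 ≤ R) (x s : ℝ) :
    -2 / (1 + s ^ 2) ≤
      (2 * barrierProfile R x - barrierProfile R (x - s) - barrierProfile R (x + s)) / s ^ 2 := by
  rcases eq_or_ne s 0 with rfl | hs
  · simp
  have hs2 : 0 < s ^ 2 := by positivity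
  have hR2 : 1 ≤ R ^ 2 := by nlinarith
  have hD0 : 0 < R ^ 2 + x ^ 2 := by positivity
  have hD1 : 0 < R ^ 2 + (x - s) ^ 2 := by positivity
  have hD2 : 0 < R ^ 2 + (x + s) ^ 2 := by positivity
  have key : (2 * barrierProfile R x - barrierProfile R (x - s) - barrierProfile R (x + s)) / s ^ 2
      = -(2 * R ^ 2 * (R ^ 2 + s ^ 2 - 3 * x ^ 2) /
        ((R ^ 2 + x ^ 2) * ((R ^ 2 + (x - s) ^ 2) * (R ^ 2 + (x + s) ^ 2)))) := by
    unfold barrierProfile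
    field_simp
    ring
  rw [key, neg_div, neg_le_neg_iff, div_le_div_iff₀ (by positivity) (by positivity)]
  have e : (R ^ 2 + (x - s) ^ 2) * (R ^ 2 + (x + s) ^ 2)
      = (R ^ 2 + s ^ 2 - x ^ 2) ^ 2 + 4 * R ^ 2 * x ^ 2 := by ring
  rw [e]
  set c := R ^ 2 + s ^ 2 with hc
  set D := (c - x ^ 2) ^ 2 + 4 * R ^ 2 * x ^ 2 with hDdef
  have hDpos : 0 ≤ D := by positivity
  have h1 : (c - 3 * x ^ 2) * c ≤ D := by
    have : 0 ≤ x ^ 2 * c := by positivity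
    have : 0 ≤ R ^ 2 * x ^ 2 := by positivity
    nlinarith [sq_nonneg (x ^ 2)]
  have h2 : (c - 3 * x ^ 2) * (1 + s ^ 2) ≤ D := by
    rcases le_total (c - 3 * x ^ 2) 0 with hn | hn
    · exact (mul_nonpos_of_nonpos_of_nonneg hn (by positivity)).trans hDpos
    · exact (mul_le_mul_of_nonneg_left (by linarith) hn).trans h1
  have h3 : R ^ 2 * ((c - 3 * x ^ 2) * (1 + s ^ 2)) ≤ R ^ 2 * D := by gcongr
  have h4 : 0 ≤ x ^ 2 * D := by positivity
  nlinarith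

/-- Finite speed of propagation up to a small error: a bound of the initial datum on a large
interval persists at its centre. -/
theorem IsDysonSolution.exists_radius_le {F Ft Fx : ℝ → ℝ → ℝ} {M : ℝ}
    (h : IsDysonSolution F Ft Fx M) {ε T : ℝ} (hε : 0 < ε) (hT : 0 ≤ T) :
    ∃ R > 0, ∀ z c, (∀ x, |x - z| ≤ R → F 0 x ≤ c) → ∀ t, 0 ≤ t → t ≤ T → F t z ≤ c + ε := by
  have hM : 0 ≤ M := (abs_nonneg _).trans (h.bound 0 0 le_rfl)
  set B : ℝ := 4 * M + 2 with hB
  have hB0 : 0 < B := by positivity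
  set η : ℝ := ε / (T + 1) with hη
  have hη0 : 0 < η := by positivity
  have hηT : η * T ≤ ε := by
    rw [hη, div_mul_eq_mul_div, div_le_iff₀ (by positivity)]
    nlinarith
  set R : ℝ := 1 + Real.pi * B ^ 2 / η with hRdef
  have hπ := Real.pi_pos
  have hR1 : 1 ≤ R := by
    have : 0 ≤ Real.pi * B ^ 2 / η := by positivity
    linarith
  have hR0 : 0 < R := by linarith
  have hRη : Real.pi * B ^ 2 / R < η := by
    rw [div_lt_iff₀ hR0, hRdef, mul_add, mul_div_cancel₀ _ hη0.ne']
    linarith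
  refine ⟨R, hR0, fun z c hc t₁ ht₁ ht₁T => ?_⟩
  by_contra! hlt
  have hcM : -M ≤ c := by
    have h1 := (abs_le.1 (h.bound 0 z le_rfl)).1
    have h2 := hc z (by simpa using hR0.le)
    linarith
  obtain ⟨t₀, x₀, ht₀, ht₀T, hmax⟩ := exists_max_pos_time
    (u := fun t x => F t x - (c + η * t + B * barrierProfile R (x - z))) (T := T)
    (a := z - R) (b := z + R) (t₁ := t₁) (x₁ := z) (by
      have h1 := h.cont
      have h2 := continuous_barrierProfile hR0
      have h3 : Continuous fun p : ℝ × ℝ =>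
        c + η * p.1 + B * barrierProfile R (p.2 - z) := by fun_prop
      exact h1.sub h3.continuousOn) ht₁ ht₁T (by
      have h1 : η * t₁ ≤ η * T := by gcongr
      have h2 : barrierProfile R (z - z) = 0 := by simp [barrierProfile]
      simp only [h2]
      linarith) (by
      intro x
      have h0 := mul_nonneg hB0.le (barrierProfile_nonneg R (x - z))
      rcases le_total |x - z| R with hx | hx
      · have := hc x hx
        linarith
      · have h1 := mul_le_mul_of_nonneg_left (half_le_barrierProfile hR0 hx) hB0.le
        have h2 := (abs_le.1 (h.bound 0 x le_rfl)).2
        linarith) (by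
      intro t x ht _ hx
      have hx' : R ≤ |x - z| := by
        by_contra! hlt'
        have := abs_lt.1 hlt'
        exact hx ⟨by linarith, by linarith⟩
      have h1 := mul_le_mul_of_nonneg_left (half_le_barrierProfile hR0 hx') hB0.le
      have h2 := (abs_le.1 (h.bound t x ht)).2
      have h3 : 0 ≤ η * t := by positivity
      linarith)
  have hFt : 0 ≤ Ft t₀ x₀ - η := by
    have hd : HasDerivAt (fun s => F s x₀ - (c + η * s + B * barrierProfile R (x₀ - z)))
        (Ft t₀ x₀ - η) t₀ := by
      have h1 := (((hasDerivAt_id t₀).const_mul η).const_add c).add_const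
        (B * barrierProfile R (x₀ - z))
      exact ((h.deriv_time t₀ x₀ ht₀).sub h1).congr_deriv (by simp)
    exact hd.nonneg_of_left_max ht₀ fun s hs hs' => hmax s x₀ hs (hs'.trans ht₀T)
  have hFx0 : 0 ≤ Fx t₀ x₀ := h.deriv_space_nonneg ht₀.le x₀
  have hFxR : Fx t₀ x₀ ≤ B / R := by
    obtain ⟨d, hd, hdR⟩ := exists_hasDerivAt_barrierProfile hR0 (x₀ - z)
    have h1 : HasDerivAt (fun x => F t₀ x - (c + η * t₀ + B * barrierProfile R (x - z)))
        (Fx t₀ x₀ - B * d) x₀ :=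
      (h.deriv_space t₀ x₀ ht₀.le).sub
        (((hd.comp_sub_const x₀ z).const_mul B).const_add _)
    have h2 : IsLocalMax (fun x => F t₀ x - (c + η * t₀ + B * barrierProfile R (x - z))) x₀ :=
      Eventually.of_forall fun x => hmax t₀ x ht₀.le ht₀T
    have h3 := h2.hasDerivAt_eq_zero h1
    have h4 := mul_le_mul_of_nonneg_left hdR hB0.le
    rw [mul_one_div] at h4
    linarith
  obtain ⟨L, hL, he⟩ := h.eqn t₀ x₀ ht₀
  have hLlow : -(B * Real.pi) ≤ L := by
    refine hL.ge_of_second_difference (h.continuous_space ht₀.le)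
      (fun y => h.bound t₀ y ht₀.le) hB0.le fun s => ?_
    have h1 := mul_le_mul_of_nonneg_left (barrierProfile_second_difference hR1 (x₀ - z) s) hB0.le
    have h2 := hmax t₀ (x₀ - s) ht₀.le ht₀T
    have h3 := hmax t₀ (x₀ + s) ht₀.le ht₀T
    simp only [show x₀ - s - z = x₀ - z - s by ring, show x₀ + s - z = x₀ - z + s by ring] at h2 h3
    rw [← mul_div_assoc, ← mul_div_assoc] at h1
    refine le_trans (le_of_eq (by ring)) (h1.trans ?_)
    gcongr
    linarith
  have h1 : Fx t₀ x₀ * -L ≤ Fx t₀ x₀ * (B * Real.pi) :=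
    mul_le_mul_of_nonneg_left (by linarith) hFx0
  have h2 : Fx t₀ x₀ * (B * Real.pi) ≤ B / R * (B * Real.pi) := by gcongr
  have h3 : B / R * (B * Real.pi) = Real.pi * B ^ 2 / R := by ring
  linarith

/-- Comparison near `-∞`, uniformly on bounded time intervals. -/
theorem IsDysonSolution.exists_left_le {F₁ F₂ Ft₁ Ft₂ Fx₁ Fx₂ : ℝ → ℝ → ℝ} {M : ℝ}
    (h₁ : IsDysonSolution F₁ Ft₁ Fx₁ M) (h₂ : IsDysonSolution F₂ Ft₂ Fx₂ M)
    (h0 : ∀ x, F₁ 0 x ≤ F₂ 0 x) {ε T : ℝ} (hε : 0 < ε) (hT : 0 ≤ T) :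
    ∃ a, ∀ t x, 0 ≤ t → t ≤ T → x ≤ a → F₁ t x ≤ F₂ t x + 3 * ε := by
  obtain ⟨R₁, hR₁, H₁⟩ := h₁.exists_radius_le hε hT
  obtain ⟨R₂, -, H₂⟩ := h₂.reflect.exists_radius_le hε hT
  have hbdd : BddBelow (Set.range (F₂ 0)) :=
    ⟨-M, by rintro _ ⟨x, rfl⟩; exact (abs_le.1 (h₂.bound 0 x le_rfl)).1⟩
  obtain ⟨w, hw⟩ := exists_lt_of_ciInf_lt (lt_add_of_pos_right (⨅ x, F₂ 0 x) hε)
  refine ⟨w - R₁, fun t x ht htT hx => ?_⟩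
  have h3 := H₁ x ((⨅ x, F₂ 0 x) + ε) (fun y hy => by
    have := (abs_le.1 hy).2
    exact ((h₁.mono 0 le_rfl (show y ≤ w by linarith)).trans (h0 w)).trans hw.le) t ht htT
  have h4 := H₂ (-x) (-⨅ x, F₂ 0 x) (fun y _ => neg_le_neg (ciInf_le hbdd (-y))) t ht htT
  rw [neg_neg] at h4
  linarith

theorem IsDysonSolution.comparison {F₁ F₂ Ft₁ Ft₂ Fx₁ Fx₂ : ℝ → ℝ → ℝ} {M : ℝ}
    (h₁ : IsDysonSolution F₁ Ft₁ Fx₁ M) (h₂ : IsDysonSolution F₂ Ft₂ Fx₂ M)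
    (h0 : ∀ x, F₁ 0 x ≤ F₂ 0 x) {T x₁ : ℝ} (hT : 0 ≤ T) : F₁ T x₁ ≤ F₂ T x₁ := by
  by_contra! hlt
  set δ : ℝ := F₁ T x₁ - F₂ T x₁ with hδ
  have hδ0 : 0 < δ := sub_pos.2 hlt
  set ε : ℝ := δ / 12 with hε
  have hε0 : 0 < ε := by positivity
  set η : ℝ := δ / (4 * (T + 1)) with hη
  have hη0 : 0 < η := by positivity
  have hηT : η * T ≤ δ / 4 := by
    rw [hη, div_mul_eq_mul_div, div_le_div_iff₀ (by positivity) (by norm_num)]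
    nlinarith
  obtain ⟨a, ha⟩ := h₁.exists_left_le h₂ h0 hε0 hT
  obtain ⟨b, hb⟩ := h₂.reflect.exists_left_le h₁.reflect (fun x => neg_le_neg (h0 (-x))) hε0 hT
  obtain ⟨t₀, x₀, ht₀, ht₀T, hmax⟩ := exists_max_pos_time
    (u := fun t x => F₁ t x - F₂ t x - (η * t + 3 * ε)) (T := T)
    (a := a) (b := -b) (t₁ := T) (x₁ := x₁) (by
      have h3 : Continuous fun p : ℝ × ℝ => η * p.1 + 3 * ε := by fun_prop
      exact (h₁.cont.sub h₂.cont).sub h3.continuousOn) hT le_rfl (by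
      linarith) (by
      intro x
      have := h0 x
      linarith) (by
      intro t x ht htT hx
      have h3 : 0 ≤ η * t := by positivity
      rcases le_total x a with hxa | hxa
      · have := ha t x ht htT hxa
        linarith
      · have hxb : -x ≤ b := by
          by_contra! hlt'
          exact hx ⟨hxa, by linarith⟩
        have := hb t (-x) ht htT hxb
        rw [neg_neg] at this
        linarith)
  have hFt : 0 ≤ Ft₁ t₀ x₀ - Ft₂ t₀ x₀ - η := by
    have hd : HasDerivAt (fun s => F₁ s x₀ - F₂ s x₀ - (η * s + 3 * ε))
        (Ft₁ t₀ x₀ - Ft₂ t₀ x₀ - η) t₀ := by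
      have h3 := ((hasDerivAt_id t₀).const_mul η).add_const (3 * ε)
      exact (((h₁.deriv_time t₀ x₀ ht₀).sub (h₂.deriv_time t₀ x₀ ht₀)).sub h3).congr_deriv
        (by simp)
    exact hd.nonneg_of_left_max ht₀ fun s hs hs' => hmax s x₀ hs (hs'.trans ht₀T)
  have hFx0 : 0 ≤ Fx₁ t₀ x₀ := h₁.deriv_space_nonneg ht₀.le x₀
  have hFx : Fx₁ t₀ x₀ - Fx₂ t₀ x₀ = 0 := by
    have h3 : IsLocalMax (fun x => F₁ t₀ x - F₂ t₀ x - (η * t₀ + 3 * ε)) x₀ :=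
      Eventually.of_forall fun x => hmax t₀ x ht₀.le ht₀T
    exact h3.hasDerivAt_eq_zero
      (((h₁.deriv_space t₀ x₀ ht₀.le).sub (h₂.deriv_space t₀ x₀ ht₀.le)).sub_const _)
  obtain ⟨L₁, hL₁, e₁⟩ := h₁.eqn t₀ x₀ ht₀
  obtain ⟨L₂, hL₂, e₂⟩ := h₂.eqn t₀ x₀ ht₀
  have hL : L₂ ≤ L₁ := hL₁.le_of_increments (h₁.continuous_space ht₀.le)
    (h₂.continuous_space ht₀.le) (fun y => h₁.bound t₀ y ht₀.le)
    (fun y => h₂.bound t₀ y ht₀.le) hL₂ fun y => by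
      have := hmax t₀ y ht₀.le ht₀T
      linarith
  have h3 : 0 ≤ Fx₁ t₀ x₀ * (L₁ - L₂) := mul_nonneg hFx0 (by linarith)
  have h4 : Fx₂ t₀ x₀ = Fx₁ t₀ x₀ := by linarith
  rw [h4] at e₂
  linarith

/-- Comparison principle for smooth nondecreasing solutions of the primitive
Dyson equation `∂ₜF + (∂ₓF) H̃[F(t,·)] = 0` on `(0,∞) × ℝ`: if `F₁(0,·) ≤ F₂(0,·)` then
`F₁(t,·) ≤ F₂(t,·)` for every `t ≥ 0`. -/
theorem comparison_smooth_dyson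
    (F₁ F₂ Ft₁ Ft₂ Fx₁ Fx₂ Fxx₁ Fxx₂ : ℝ → ℝ → ℝ) (M : ℝ)
    -- boundedness and continuity on [0,∞) × ℝ
    (hb₁ : ∀ t x, 0 ≤ t → |F₁ t x| ≤ M)
    (hb₂ : ∀ t x, 0 ≤ t → |F₂ t x| ≤ M)
    (hc₁ : ContinuousOn (fun p : ℝ × ℝ => F₁ p.1 p.2) (Set.Ici 0 ×ˢ Set.univ))
    (hc₂ : ContinuousOn (fun p : ℝ × ℝ => F₂ p.1 p.2) (Set.Ici 0 ×ˢ Set.univ))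
    -- differentiability in time on (0,∞) × ℝ
    (ht₁ : ∀ t x, 0 < t → HasDerivAt (fun s => F₁ s x) (Ft₁ t x) t)
    (ht₂ : ∀ t x, 0 < t → HasDerivAt (fun s => F₂ s x) (Ft₂ t x) t)
    -- for each t ≥ 0, twice differentiable in space with bounded second derivative
    (hx₁ : ∀ t x, 0 ≤ t → HasDerivAt (F₁ t) (Fx₁ t x) x)
    (hx₂ : ∀ t x, 0 ≤ t → HasDerivAt (F₂ t) (Fx₂ t x) x)
    (hxx₁ : ∀ t x, 0 ≤ t → HasDerivAt (Fx₁ t) (Fxx₁ t x) x)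
    (hxx₂ : ∀ t x, 0 ≤ t → HasDerivAt (Fx₂ t) (Fxx₂ t x) x)
    (hxxb₁ : ∀ t, 0 ≤ t → ∃ K, ∀ x, |Fxx₁ t x| ≤ K)
    (hxxb₂ : ∀ t, 0 ≤ t → ∃ K, ∀ x, |Fxx₂ t x| ≤ K)
    -- monotonicity in space
    (hmono₁ : ∀ t, 0 ≤ t → Monotone (F₁ t))
    (hmono₂ : ∀ t, 0 ≤ t → Monotone (F₂ t))
    -- the equation holds pointwise on (0,∞) × ℝ
    (heq₁ : ∀ t x, 0 < t →
      ∃ L : ℝ, HTildeTendsto (F₁ t) x L ∧ Ft₁ t x + Fx₁ t x * L = 0)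
    (heq₂ : ∀ t x, 0 < t →
      ∃ L : ℝ, HTildeTendsto (F₂ t) x L ∧ Ft₂ t x + Fx₂ t x * L = 0)
    (hinit : ∀ x, F₁ 0 x ≤ F₂ 0 x) :
    ∀ t x, 0 ≤ t → F₁ t x ≤ F₂ t x := by
  intro t x ht
  exact IsDysonSolution.comparison (M := M) ⟨hb₁, hc₁, ht₁, hx₁, hmono₁, heq₁⟩
    ⟨hb₂, hc₂, ht₂, hx₂, hmono₂, heq₂⟩ hinit ht
end
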